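/- Let k be a positive integer, Γ a group, and α: 2^Γ → ℤ a normalized polymatroidal function. If the Γ-labeled graph (G,ψ) is α-critical, then every connected subgraph of (G,ψ) is either α-critical or balanced; that is, every F ∈ C(G) is either α-critical or balanced. -/

import Mathlib

/- Formalization of count matroids of group-labeled graphs. -/

namespace CountMatroidPaper

attribute [local instance] Classical.propDecidable

/-- A `Γ`-labeled graph: a directed multigraph with edge set `E`, vertex set `V`,
and a gain (group label) on each edge. -/
structure GainGraph (V E Γ : Type*) where
  tail : E → V
  head : E → V
  gain : E → Γ

variable {V E Γ : Type*}

namespace GainGraph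

variable [Group Γ]

/-- `V(F)`: the set of vertices incident to the edge set `F`. -/
def verts [DecidableEq V] (G : GainGraph V E Γ) (F : Finset E) : Finset V :=
  F.image G.tail ∪ F.image G.head

/-- `G.GainWalk F u w g` : there is a walk from `u` to `w` using edges of `F` whose gain is `g`. -/
inductive GainWalk (G : GainGraph V E Γ) (F : Set E) (u : V) : V → Γ → Prop
  | nil : GainWalk G F u u 1
  | fwd {w : V} {g : Γ} {e : E} : GainWalk G F u w g → e ∈ F → G.tail e = w →
      GainWalk G F u (G.head e) (g * G.gain e)
  | bwd {w : V} {g : Γ} {e : E} : GainWalk G F u w g → e ∈ F → G.head e = w →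
      GainWalk G F u (G.tail e) (g * (G.gain e)⁻¹)

/-- An edge set is balanced if every closed walk in it has identity gain. -/
def Balanced (G : GainGraph V E Γ) (F : Set E) : Prop :=
  ∀ (v : V) (g : Γ), G.GainWalk F v v g → g = 1

/-- Membership in `C(G)` : a nonempty edge set `F` such that `(V(F), F)` is connected. -/
def Connected [DecidableEq V] (G : GainGraph V E Γ) (F : Finset E) : Prop :=
  F.Nonempty ∧ ∀ u ∈ G.verts F, ∀ w ∈ G.verts F, ∃ g : Γ, G.GainWalk (↑F) u w g

/-- The set of gains of closed walks based at `v` using edges of `F`. -/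
def gains (G : GainGraph V E Γ) (F : Set E) (v : V) : Set Γ :=
  {g | G.GainWalk F v v g}

/-- `α̃(F)`: the value of `α` on (a generating set of) the subgroup `⟨F⟩_{v,ψ}` for a
vertex `v ∈ V(F)`.  For a polymatroidal `α` (invariant under conjugation and under taking
generated subgroups) this is independent of the choice of `v`. -/
noncomputable def alphaTilde (α : Set Γ → ℤ) (G : GainGraph V E Γ) (F : Finset E) : ℤ :=
  if h : F.Nonempty then α (G.gains (↑F) (G.tail h.choose)) else 0

/-- Loops at `v`. -/
def loopsAt (G : GainGraph V E Γ) (v : V) : Set E :=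
  {e | G.tail e = v ∧ G.head e = v}

/-- Unbalanced (non-identity labeled) loops at `v`, i.e. `L_v \ L_v°`. -/
def unbalancedLoopsAt (G : GainGraph V E Γ) (v : V) : Set E :=
  {e | G.tail e = v ∧ G.head e = v ∧ G.gain e ≠ 1}

/-- `E_v`: edges incident to `v`. -/
def incidentAt (G : GainGraph V E Γ) (v : V) : Set E :=
  {e | G.tail e = v ∨ G.head e = v}

/-- Non-loop edges incident to `v`. -/
def nonloopAt (G : GainGraph V E Γ) (v : V) : Set E :=
  {e | (G.tail e = v ∨ G.head e = v) ∧ G.tail e ≠ G.head e}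

/-- The split of `(G,ψ)` at `v` with respect to the bipartition `{E₁, E₂}` of the non-loop
edges incident to `v`, where `B = E₂`: the vertex `v` is split into `v₁ = Sum.inl v` and
`v₂ = Sum.inr ()`; edges in `B` become incident to `v₂`, the remaining non-loop edges at `v`
to `v₁`; balanced loops at `v` stay loops at `v₁`, and unbalanced loops at `v` become arcs
from `v₁` to `v₂`, keeping the labeling. -/
noncomputable def split (G : GainGraph V E Γ) (v : V) (B : Set E) :
    GainGraph (V ⊕ Unit) E Γ where
  tail e :=
    if G.tail e = v ∧ G.head e = v then Sum.inl v
    else if G.tail e = v ∧ e ∈ B then Sum.inr ()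
    else Sum.inl (G.tail e)
  head e :=
    if G.tail e = v ∧ G.head e = v then
      (if G.gain e = 1 then Sum.inl v else Sum.inr ())
    else if G.head e = v ∧ e ∈ B then Sum.inr ()
    else Sum.inl (G.head e)
  gain := G.gain

/-- `v` is a base for the near-balancedness of `F`, witnessed by the part `B` of the
bipartition of the non-loop edges at `v`: the corresponding split makes `F` balanced. -/
def IsSplitBase (G : GainGraph V E Γ) (F : Finset E) (v : V) (B : Set E) : Prop :=
  B ⊆ G.nonloopAt v ∧ Balanced (G.split v B) (↑F)

/-- A connected edge set is near-balanced if it is unbalanced and some split of `(G,ψ)`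
makes it balanced. -/
def NearBalanced (G : GainGraph V E Γ) (F : Finset E) : Prop :=
  ¬ G.Balanced (↑F) ∧ ∃ (v : V) (B : Set E), G.IsSplitBase F v B

/-- `K` is an extra edge set for the near-balancedness of `F` with base `v`:
`K = E₂ ∪ (L_v \ L_v°)` (or `E₁ ∪ (L_v \ L_v°)`) for a balanced split at `v` with
bipartition `{E₁, E₂}`. -/
def ExtraEdgeSet (G : GainGraph V E Γ) (F : Finset E) (v : V) (K : Set E) : Prop :=
  ∃ B : Set E, G.IsSplitBase F v B ∧
    (K = B ∪ G.unbalancedLoopsAt v ∨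
     K = (G.nonloopAt v \ B) ∪ G.unbalancedLoopsAt v)

/-- `β(F)`. -/
noncomputable def beta (α : Set Γ → ℤ) (k : ℤ) [DecidableEq V]
    (G : GainGraph V E Γ) (F : Finset E) : ℤ :=
  if G.NearBalanced F then min (alphaTilde α G F) k else alphaTilde α G F

/-- `f_α(F) = k|V(F)| - ℓ + β(F)`. -/
noncomputable def fAlpha (α : Set Γ → ℤ) (k ℓ : ℤ) [DecidableEq V]
    (G : GainGraph V E Γ) (F : Finset E) : ℤ :=
  k * ((G.verts F).card : ℤ) - ℓ + beta α k G F

/-- `I` is `f_α`-sparse: `|F| ≤ f_α(F)` for every `F ∈ C(G)` with `F ⊆ I`. -/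
def Sparse (α : Set Γ → ℤ) (k ℓ : ℤ) [DecidableEq V]
    (G : GainGraph V E Γ) (I : Finset E) : Prop :=
  ∀ F : Finset E, F ⊆ I → G.Connected F → (F.card : ℤ) ≤ fAlpha α k ℓ G F

/-- `F` is `f_α`-tight: connected, `f_α`-sparse, with `|F| = f_α(F)`. -/
def Tight (α : Set Γ → ℤ) (k ℓ : ℤ) [DecidableEq V]
    (G : GainGraph V E Γ) (F : Finset E) : Prop :=
  G.Connected F ∧ Sparse α k ℓ G F ∧ (F.card : ℤ) = fAlpha α k ℓ G F

/-- An edge set `Y` is `f_α`-full: the subgraph `(V(Y), Y)` contains a spanning connected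
`f_α`-sparse subgraph `G'` with `β(E(G')) = β(Y)` and
`|E(G')| ≥ k|V(G')| - ℓ + min{β(E(G')), 2k - ℓ + 1}`. -/
def Full (α : Set Γ → ℤ) (k ℓ : ℤ) [DecidableEq V]
    (G : GainGraph V E Γ) (Y : Finset E) : Prop :=
  ∃ E' : Finset E, E' ⊆ Y ∧ G.Connected E' ∧ G.verts E' = G.verts Y ∧
    Sparse α k ℓ G E' ∧ beta α k G E' = beta α k G Y ∧
    k * ((G.verts E').card : ℤ) - ℓ + min (beta α k G E') (2 * k - ℓ + 1) ≤ (E'.card : ℤ)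

/-- The graph `(G,ψ)` is `f_α`-full: it contains a spanning connected `f_α`-sparse
subgraph `G'` with `β(E(G')) = β(E(G))` and
`|E(G')| ≥ k|V(G')| - ℓ + min{β(E(G')), 2k - ℓ + 1}`. -/
def FullGraph [Fintype V] [Fintype E] [DecidableEq V]
    (α : Set Γ → ℤ) (k ℓ : ℤ) (G : GainGraph V E Γ) : Prop :=
  ∃ E' : Finset E, G.Connected E' ∧ G.verts E' = Finset.univ ∧
    Sparse α k ℓ G E' ∧ beta α k G E' = beta α k G (Finset.univ : Finset E) ∧
    k * ((G.verts E').card : ℤ) - ℓ + min (beta α k G E') (2 * k - ℓ + 1) ≤ (E'.card : ℤ)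

/-- `F` is `α`-critical: connected, near-balanced, and `α̃(F) > k`. -/
def AlphaCritical (α : Set Γ → ℤ) (k : ℤ) [DecidableEq V]
    (G : GainGraph V E Γ) (F : Finset E) : Prop :=
  G.Connected F ∧ G.NearBalanced F ∧ k < alphaTilde α G F

/-- Switching at `v` with `g`. -/
noncomputable def switch (G : GainGraph V E Γ) (v : V) (g : Γ) : GainGraph V E Γ where
  tail := G.tail
  head := G.head
  gain e :=
    if G.tail e = v ∧ G.head e = v then g * G.gain e * g⁻¹
    else if G.tail e = v then g * G.gain e
    else if G.head e = v then G.gain e * g⁻¹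
    else G.gain e

/-- Two gain functions (on the same underlying graph) are equivalent if one is obtained
from the other by a sequence of switchings. -/
def Equivalent (G G' : GainGraph V E Γ) : Prop :=
  Relation.ReflTransGen (fun H H' : GainGraph V E Γ => ∃ (v : V) (g : Γ), H' = H.switch v g) G G'

/-- The label of the edge `e`, re-oriented so that `e` is directed towards `v`. -/
noncomputable def orientTo (G : GainGraph V E Γ) (v : V) (e : E) : Γ :=
  if G.head e = v then G.gain e else (G.gain e)⁻¹

/-- Adjacency in `G - v`. -/
def AdjAvoid (G : GainGraph V E Γ) (v u w : V) : Prop :=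
  u ≠ v ∧ w ≠ v ∧ ∃ e : E, (G.tail e = u ∧ G.head e = w) ∨ (G.tail e = w ∧ G.head e = u)

/-- `S` is (the edge set of) a fraction of `v`: the subgraph of `G - L_v` induced by `v`
together with the vertex set of a connected component of `G - v`. -/
def IsFraction [Fintype E] (G : GainGraph V E Γ) (v : V) (S : Finset E) : Prop :=
  ∃ u : V, u ≠ v ∧
    S = Finset.univ.filter (fun e =>
      ¬ (G.tail e = v ∧ G.head e = v) ∧
      (G.tail e = v ∨ Relation.ReflTransGen (G.AdjAvoid v) u (G.tail e)) ∧
      (G.head e = v ∨ Relation.ReflTransGen (G.AdjAvoid v) u (G.head e)))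

/-- `I` is `(k,m)`-sparse: `|F| ≤ k|V(F)| - m` for every nonempty `F ⊆ I`. -/
def CountSparse [DecidableEq V] (G : GainGraph V E Γ) (k m : ℤ) (I : Finset E) : Prop :=
  ∀ F : Finset E, F ⊆ I → F.Nonempty → (F.card : ℤ) ≤ k * ((G.verts F).card : ℤ) - m

/-- `C` is a circuit of the `(k,m)`-count matroid `M_{k,m}(G)`: a minimal set that is
not `(k,m)`-sparse. -/
def CountCircuit [DecidableEq V] (G : GainGraph V E Γ) (k m : ℤ) (C : Finset E) : Prop :=
  ¬ G.CountSparse k m C ∧ ∀ C' : Finset E, C' ⊆ C → C' ≠ C → G.CountSparse k m C'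

end GainGraph

/-- `α : 2^Γ → ℤ` is polymatroidal. -/
structure Polymatroidal [Group Γ] (α : Set Γ → ℤ) : Prop where
  empty : α ∅ = 0
  submodular : ∀ X Y : Set Γ, α (X ∪ Y) + α (X ∩ Y) ≤ α X + α Y
  mono : ∀ X Y : Set Γ, X ⊆ Y → α X ≤ α Y
  conj : ∀ (X : Set Γ) (γ : Γ), α ((fun x => γ * x * γ⁻¹) '' X) = α X
  clos : ∀ X : Set Γ, α ((Subgroup.closure X : Subgroup Γ) : Set Γ) = α X

/-- A polymatroidal function is normalized if `α({g}) ≠ 0` for every non-identity `g`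
and `α({1}) = 0`. -/
def Normalized [Group Γ] (α : Set Γ → ℤ) : Prop :=
  (∀ g : Γ, g ≠ 1 → α {g} ≠ 0) ∧ α ({1} : Set Γ) = 0

/-- The smoothness condition: `α(S ∪ {g}) - α(S) > k` implies `S = {1}` and `g² ≠ 1`. -/
def Smooth [Group Γ] (α : Set Γ → ℤ) (k : ℤ) : Prop :=
  ∀ (S : Set Γ) (g : Γ), S.Nonempty → k < α (S ∪ {g}) - α S →
    S = ({1} : Set Γ) ∧ g ^ 2 ≠ 1


namespace GainGraph

variable [Group Γ]

lemma GainWalk.trans {G : GainGraph V E Γ} {F : Set E} {u w x : V} {g h : Γ}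
    (h₁ : G.GainWalk F u w g) (h₂ : G.GainWalk F w x h) : G.GainWalk F u x (g * h) := by
  induction h₂ with
  | nil => simpa using h₁
  | fwd _ he ht ih => rw [← mul_assoc]; exact .fwd ih he ht
  | bwd _ he ht ih => rw [← mul_assoc]; exact .bwd ih he ht

lemma GainWalk.symm {G : GainGraph V E Γ} {F : Set E} {u w : V} {g : Γ}
    (h : G.GainWalk F u w g) : G.GainWalk F w u g⁻¹ := by
  induction h with
  | nil => simpa using GainWalk.nil
  | @fwd w g e _ he ht ih =>
    subst ht
    rw [mul_inv_rev]
    refine GainWalk.trans ?_ ih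
    simpa using GainWalk.bwd (GainWalk.nil (G := G) (F := F) (u := G.head e)) he rfl
  | @bwd w g e _ he ht ih =>
    subst ht
    rw [mul_inv_rev]
    refine GainWalk.trans ?_ ih
    simpa using GainWalk.fwd (GainWalk.nil (G := G) (F := F) (u := G.tail e)) he rfl

lemma GainWalk.mono {G : GainGraph V E Γ} {F F' : Set E} (hF : F ⊆ F') {u w : V} {g : Γ}
    (h : G.GainWalk F u w g) : G.GainWalk F' u w g := by
  induction h with
  | nil => exact .nil
  | fwd _ he ht ih => exact .fwd ih (hF he) ht
  | bwd _ he ht ih => exact .bwd ih (hF he) ht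

lemma Balanced.mono {G : GainGraph V E Γ} {F F' : Set E} (hF : F ⊆ F')
    (h : G.Balanced F') : G.Balanced F :=
  fun v g hg => h v g (hg.mono hF)

/-- `p` is a potential for `F`: the gain of each edge of `F` is the quotient of the values of `p`
at its ends. -/
def IsPotential (G : GainGraph V E Γ) (F : Set E) (p : V → Γ) : Prop :=
  ∀ e ∈ F, p (G.head e) = p (G.tail e) * G.gain e

lemma IsPotential.eq_of_gainWalk {G : GainGraph V E Γ} {F : Set E} {p : V → Γ}
    (hp : G.IsPotential F p) {u w : V} {g : Γ} (h : G.GainWalk F u w g) :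
    p w = p u * g := by
  induction h with
  | nil => simp
  | fwd _ he ht ih => subst ht; rw [hp _ he, ih, mul_assoc]
  | bwd _ he ht ih => subst ht; rw [← mul_assoc, ← ih, hp _ he]; simp

lemma IsPotential.balanced {G : GainGraph V E Γ} {F : Set E} {p : V → Γ}
    (hp : G.IsPotential F p) : G.Balanced F :=
  fun _ _ h => by simpa using hp.eq_of_gainWalk h

/-- Being joined by a walk in `F`. -/
def walkSetoid (G : GainGraph V E Γ) (F : Set E) : Setoid V where
  r u w := ∃ g, G.GainWalk F u w g
  iseqv := ⟨fun _ => ⟨1, .nil⟩, fun ⟨_, h⟩ => ⟨_, h.symm⟩, fun ⟨_, h⟩ ⟨_, h'⟩ => ⟨_, h.trans h'⟩⟩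

lemma Balanced.exists_isPotential {G : GainGraph V E Γ} {F : Set E} (h : G.Balanced F) :
    ∃ p, G.IsPotential F p := by
  let := G.walkSetoid F
  have hr : ∀ w : V, ∃ g, G.GainWalk F (⟦w⟧ : Quotient (G.walkSetoid F)).out w g :=
    fun w => Quotient.mk_out w
  choose p hp using hr
  refine ⟨p, fun e he => ?_⟩
  have hq : (⟦G.head e⟧ : Quotient (G.walkSetoid F)) = ⟦G.tail e⟧ :=
    Quotient.sound ⟨_, (GainWalk.fwd .nil he rfl).symm⟩
  have h₁ := hp (G.head e)
  rw [hq] at h₁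
  exact (inv_mul_eq_one.mp (h _ _ (((GainWalk.fwd (hp (G.tail e)) he rfl).symm).trans h₁))).symm

/-- The map identifying the two halves of a split vertex. -/
def unsplit (v : V) : V ⊕ Unit → V := Sum.elim id fun _ => v

lemma unsplit_split_tail (G : GainGraph V E Γ) (v : V) (B : Set E) (e : E) :
    unsplit v ((G.split v B).tail e) = G.tail e := by
  simp only [split]
  split_ifs <;> simp_all [unsplit]

lemma unsplit_split_head (G : GainGraph V E Γ) (v : V) (B : Set E) (e : E) :
    unsplit v ((G.split v B).head e) = G.head e := by
  simp only [split]
  split_ifs <;> simp_all [unsplit]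

lemma GainWalk.unsplit {G : GainGraph V E Γ} {v : V} {B F : Set E} {u w : V ⊕ Unit} {g : Γ}
    (h : (G.split v B).GainWalk F u w g) :
    G.GainWalk F (unsplit v u) (unsplit v w) g := by
  induction h with
  | nil => exact .nil
  | @fwd w g e _ he ht ih =>
    subst ht
    rw [unsplit_split_tail] at ih
    rw [unsplit_split_head]
    exact .fwd ih he rfl
  | @bwd w g e _ he ht ih =>
    subst ht
    rw [unsplit_split_head] at ih
    rw [unsplit_split_tail]
    exact .bwd ih he rfl

omit [Group Γ] in
lemma tail_mem_verts [DecidableEq V] (G : GainGraph V E Γ) {F : Finset E} {e : E} (he : e ∈ F) :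
    G.tail e ∈ G.verts F :=
  Finset.mem_union_left _ (Finset.mem_image_of_mem _ he)

omit [Group Γ] in
lemma head_mem_verts [DecidableEq V] (G : GainGraph V E Γ) {F : Finset E} {e : E} (he : e ∈ F) :
    G.head e ∈ G.verts F :=
  Finset.mem_union_right _ (Finset.mem_image_of_mem _ he)

lemma GainWalk.unsplit_mem_verts [DecidableEq V] {G : GainGraph V E Γ} {v : V} {B : Set E}
    {F : Finset E} {u w : V ⊕ Unit} {g : Γ} (h : (G.split v B).GainWalk (↑F) u w g)
    (hne : w ≠ u) : GainGraph.unsplit v w ∈ G.verts F := by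
  cases h with
  | nil => exact absurd rfl hne
  | fwd _ he _ => rw [unsplit_split_head]; exact G.head_mem_verts he
  | bwd _ he _ => rw [unsplit_split_tail]; exact G.tail_mem_verts he

lemma IsPotential.balanced_of_split {G : GainGraph V E Γ} {v : V} {B F : Set E}
    {p : V ⊕ Unit → Γ} (hp : (G.split v B).IsPotential F p)
    (h : p (Sum.inl v) = p (Sum.inr ())) : G.Balanced F := by
  have hq : ∀ y, p (Sum.inl (unsplit v y)) = p y := by
    rintro (y | y)
    · rfl
    · exact h
  refine IsPotential.balanced (p := fun w => p (Sum.inl w)) fun e he => ?_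
  have := hp e he
  rwa [← hq, ← hq ((G.split v B).tail e), unsplit_split_head, unsplit_split_tail] at this

/-- If a split makes `F` balanced while `F` itself is unbalanced, then the two halves of the split
vertex are joined by a walk in `F`. -/
lemma exists_gainWalk_of_not_balanced {G : GainGraph V E Γ} {v : V} {B F : Set E}
    (hs : (G.split v B).Balanced F) (hF : ¬ G.Balanced F) :
    ∃ g, (G.split v B).GainWalk F (Sum.inl v) (Sum.inr ()) g := by
  by_contra hno
  obtain ⟨p, hp⟩ := hs.exists_isPotential
  let c : V ⊕ Unit → Γ := fun y =>
    if ∃ g, (G.split v B).GainWalk F (Sum.inl v) y g then (p (Sum.inl v))⁻¹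
    else (p (Sum.inr ()))⁻¹
  refine hF (IsPotential.balanced_of_split (v := v) (B := B) (p := fun y => c y * p y) ?_ ?_)
  · intro e he
    have hc : c ((G.split v B).head e) = c ((G.split v B).tail e) := by
      have : (∃ g, (G.split v B).GainWalk F (Sum.inl v) ((G.split v B).head e) g) ↔
          ∃ g, (G.split v B).GainWalk F (Sum.inl v) ((G.split v B).tail e) g :=
        ⟨fun ⟨_, h⟩ => ⟨_, .bwd h he rfl⟩, fun ⟨_, h⟩ => ⟨_, .fwd h he rfl⟩⟩
      simp only [c, this]
    simp only [hc, hp e he, mul_assoc]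
  · have h₁ : ∃ g, (G.split v B).GainWalk F (Sum.inl v) (Sum.inl v) g := ⟨1, .nil⟩
    simp only [c, if_pos h₁, if_neg hno, inv_mul_cancel]

/-- In a graph made balanced by a split at `v`, every closed walk at `v` has as gain a power of the
gain of any walk joining the two halves of `v`. -/
lemma gains_subset_zpowers {G : GainGraph V E Γ} {v : V} {B F : Set E} {g : Γ}
    (hs : (G.split v B).Balanced F)
    (hg : (G.split v B).GainWalk F (Sum.inl v) (Sum.inr ()) g) :
    G.gains F v ⊆ Subgroup.zpowers g := by
  obtain ⟨p, hp⟩ := hs.exists_isPotential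
  have hpg : p (Sum.inr ()) = p (Sum.inl v) * g := hp.eq_of_gainWalk hg
  set a := p (Sum.inl v) with ha
  have hfib : ∀ y, a⁻¹ * p y * (p (Sum.inl (unsplit v y)))⁻¹ * a ∈ Subgroup.zpowers g := by
    rintro (y | y)
    · simp [unsplit]
    · simp [unsplit, hpg, ← ha]
  have key : ∀ {w x}, G.GainWalk F v w x →
      x * (p (Sum.inl w))⁻¹ * a ∈ Subgroup.zpowers g := by
    intro w x h
    induction h with
    | nil => simp [← ha]
    | @fwd w x e _ he ht ih =>
      subst ht
      have h₁ := hfib ((G.split v B).tail e)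
      have h₂ := hfib ((G.split v B).head e)
      rw [unsplit_split_tail] at h₁
      rw [unsplit_split_head, hp e he] at h₂
      convert mul_mem (mul_mem ih (inv_mem h₁)) h₂ using 1
      simp only [split]
      group
    | @bwd w x e _ he ht ih =>
      subst ht
      have h₁ := hfib ((G.split v B).tail e)
      have h₂ := hfib ((G.split v B).head e)
      rw [unsplit_split_tail] at h₁
      rw [unsplit_split_head, hp e he] at h₂
      convert mul_mem (mul_mem ih (inv_mem h₂)) h₁ using 1
      simp only [split]
      group
  intro x hx
  simpa [← ha] using key hx

lemma zpowers_subset_gains {G : GainGraph V E Γ} {F : Set E} {v : V} {g : Γ}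
    (hg : g ∈ G.gains F v) : (Subgroup.zpowers g : Set Γ) ⊆ G.gains F v := by
  let S : Subgroup Γ :=
    { carrier := G.gains F v
      mul_mem' := fun h h' => GainWalk.trans h h'
      one_mem' := GainWalk.nil
      inv_mem' := fun h => GainWalk.symm h }
  exact (Subgroup.zpowers_le (H := S)).mpr hg

lemma GainWalk.gains_eq {G : GainGraph V E Γ} {F : Set E} {u w : V} {g : Γ}
    (h : G.GainWalk F u w g) : G.gains F u = (fun x => g * x * g⁻¹) '' G.gains F w := by
  ext x
  constructor
  · intro hx
    exact ⟨g⁻¹ * x * g, (h.symm.trans hx).trans h, by group⟩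
  · rintro ⟨y, hy, rfl⟩
    exact (h.trans hy).trans h.symm

lemma alphaTilde_eq [DecidableEq V] {α : Set Γ → ℤ} (hα : Polymatroidal α)
    {G : GainGraph V E Γ} {F : Finset E} (hF : G.Connected F) {v : V} (hv : v ∈ G.verts F) :
    alphaTilde α G F = α (G.gains (↑F) v) := by
  obtain ⟨g, hg⟩ := hF.2 _ (G.tail_mem_verts hF.1.choose_spec) v hv
  rw [alphaTilde, dif_pos hF.1, hg.gains_eq, hα.conj]

end GainGraph

/-- Lemma 5: if `(G,ψ)` is `α`-critical, then every connected subgraph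
of `(G,ψ)` is either `α`-critical or balanced. -/
theorem statement13 {V E Γ : Type} [Fintype V] [DecidableEq V] [Fintype E] [DecidableEq E]
    [Group Γ] (k : ℤ) (hk : 1 ≤ k)
    (α : Set Γ → ℤ) (hpoly : Polymatroidal α) (hnorm : Normalized α)
    (G : GainGraph V E Γ)
    (hcrit : GainGraph.AlphaCritical α k G (Finset.univ : Finset E)) :
    ∀ F : Finset E, G.Connected F →
      GainGraph.AlphaCritical α k G F ∨ G.Balanced (↑F) := by
  intro F hF
  by_cases hbal : G.Balanced (↑F)
  · exact .inr hbal
  obtain ⟨hconn, ⟨-, v, B, hB, hs⟩, hlt⟩ := hcrit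
  have hsub : (↑F : Set E) ⊆ ↑(Finset.univ : Finset E) :=
    Finset.coe_subset.mpr (Finset.subset_univ F)
  have hsF := hs.mono hsub
  obtain ⟨g, hg⟩ := GainGraph.exists_gainWalk_of_not_balanced hsF hbal
  have hvF : v ∈ G.verts F := hg.unsplit_mem_verts Sum.inr_ne_inl
  have hvE : v ∈ G.verts Finset.univ := (hg.mono hsub).unsplit_mem_verts Sum.inr_ne_inl
  refine .inl ⟨hF, ⟨hbal, v, B, hB, hsF⟩, hlt.trans_le ?_⟩
  rw [GainGraph.alphaTilde_eq hpoly hconn hvE, GainGraph.alphaTilde_eq hpoly hF hvF]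
  exact hpoly.mono _ _ ((GainGraph.gains_subset_zpowers hs (hg.mono hsub)).trans
    (GainGraph.zpowers_subset_gains hg.unsplit))

end CountMatroidPaper
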